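/- Let u ∈ ℝ^N, φ_{abc} = u_a·δ_{bc}, D' = λ_d + λ_p·(N·α₁ + α₂ + α₃) + N^{1/2}·λ_t with D' ≠ 0, and assume |u|² = −λ₂·N²/D'. Then: (1) the tensor field χ_{abc} = u_a·δ_{bc} (the solution direction itself) satisfies H(φ)χ = −2λ₂·χ; (2) for any symmetric matrix S ∈ ℝ^{N×N} with trace zero, the tensor field χ'_{abc} = u_a·S_{bc} satisfies H(φ)χ' = [−2λ₂·(N^{1/2}·λ_t + (α₂+α₃)·λ_p)/D']·χ'. -/

import Mathlib

open Finset

/-- The potential of the quartic `O(N)^3` tensor model. -/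
noncomputable def potV (N : ℕ) (l2 ld lp lt a1 a2 a3 : ℝ)
    (φ : Fin N → Fin N → Fin N → ℝ) : ℝ :=
  l2 / 2 * (∑ a, ∑ b, ∑ c, (φ a b c) ^ 2)
  + ld / (4 * (N : ℝ) ^ 3) * (∑ a, ∑ b, ∑ c, (φ a b c) ^ 2) ^ 2
  + lp / (4 * (N : ℝ) ^ 2) *
      (a1 * ∑ a, ∑ b, ∑ c, ∑ a', ∑ b', ∑ c',
          φ a b c * φ a b' c' * φ a' b' c' * φ a' b c
       + a2 * ∑ a, ∑ b, ∑ c, ∑ a', ∑ b', ∑ c',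
          φ a b c * φ a' b c' * φ a' b' c' * φ a b' c
       + a3 * ∑ a, ∑ b, ∑ c, ∑ a', ∑ b', ∑ c',
          φ a b c * φ a' b' c * φ a' b' c' * φ a b c')
  + lt / (4 * (N : ℝ) ^ ((3 : ℝ) / 2)) *
      ∑ a, ∑ b, ∑ c, ∑ a', ∑ b', ∑ c',
        φ a b c * φ a b' c' * φ a' b c' * φ a' b' c

/-- The field equations of the quartic `O(N)^3` tensor model (vanishing gradient of `potV`). -/
def FieldEqs (N : ℕ) (l2 ld lp lt a1 a2 a3 : ℝ)
    (φ : Fin N → Fin N → Fin N → ℝ) : Prop :=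
  ∀ a b c,
    l2 * φ a b c
    + ld / (N : ℝ) ^ 3 * (∑ a', ∑ b', ∑ c', (φ a' b' c') ^ 2) * φ a b c
    + lp / (N : ℝ) ^ 2 *
        (a1 * ∑ a', ∑ b', ∑ c', φ a b' c' * φ a' b' c' * φ a' b c
         + a2 * ∑ a', ∑ b', ∑ c', φ a' b c' * φ a' b' c' * φ a b' c
         + a3 * ∑ a', ∑ b', ∑ c', φ a' b' c * φ a' b' c' * φ a b c')
    + lt / (N : ℝ) ^ ((3 : ℝ) / 2) *
        ∑ a', ∑ b', ∑ c', φ a b' c' * φ a' b c' * φ a' b' c = 0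

/-- The Hessian of `potV` at `φ` (the matrix of second partial derivatives
`H(φ)_{abc,a'b'c'} = ∂²V/∂φ_{abc}∂φ_{a'b'c'}`), acting on a tensor field `χ` by
`(H(φ)χ)_{abc} = Σ_{a'b'c'} H(φ)_{abc,a'b'c'} χ_{a'b'c'}`. -/
noncomputable def hessApply (N : ℕ) (l2 ld lp lt a1 a2 a3 : ℝ)
    (φ χ : Fin N → Fin N → Fin N → ℝ) : Fin N → Fin N → Fin N → ℝ :=
  fun a b c =>
    deriv (fun s : ℝ =>
      deriv (fun t : ℝ =>
        potV N l2 ld lp lt a1 a2 a3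
          (fun a' b' c' => φ a' b' c' + t * χ a' b' c'
            + s * (if a' = a ∧ b' = b ∧ c' = c then (1 : ℝ) else 0))) 0) 0

lemma deriv_poly4 (c0 c1 c2 c3 c4 : ℝ) :
    deriv (fun t : ℝ => c0 + t * c1 + t ^ 2 * c2 + t ^ 3 * c3 + t ^ 4 * c4) 0 = c1 := by
  have h : HasDerivAt (fun t : ℝ => c0 + t * c1 + t ^ 2 * c2 + t ^ 3 * c3 + t ^ 4 * c4)
      (0 + 1 * c1 + ((2 : ℕ) * (0 : ℝ) ^ (2 - 1)) * c2 + ((3 : ℕ) * (0 : ℝ) ^ (3 - 1)) * c3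
        + ((4 : ℕ) * (0 : ℝ) ^ (4 - 1)) * c4) 0 :=
    (((((hasDerivAt_const (0 : ℝ) c0).add ((hasDerivAt_id (0 : ℝ)).mul_const c1)).add
      ((hasDerivAt_pow 2 (0 : ℝ)).mul_const c2)).add
      ((hasDerivAt_pow 3 (0 : ℝ)).mul_const c3)).add
      ((hasDerivAt_pow 4 (0 : ℝ)).mul_const c4))
  rw [h.deriv]
  norm_num

/-- Second derivative of a quadratic plus quartic form with Klein four symmetry. -/
lemma hess_abs {E : Type*} [AddCommGroup E] [Module ℝ E] (M : E → E → ℝ)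
    (Q : E → E → E → E → ℝ)
    (Ml : ∀ f f' g (t : ℝ), M (f + t • f') g = M f g + t * M f' g)
    (Ms : ∀ f g, M f g = M g f)
    (Ql : ∀ f f' g h k (t : ℝ), Q (f + t • f') g h k = Q f g h k + t * Q f' g h k)
    (Q1 : ∀ f g h k, Q f g h k = Q g f k h)
    (Q2 : ∀ f g h k, Q f g h k = Q h k f g) (φ χ e : E) :
    deriv (fun s : ℝ => deriv (fun t : ℝ =>
      M (φ + t • χ + s • e) (φ + t • χ + s • e)
      + Q (φ + t • χ + s • e) (φ + t • χ + s • e) (φ + t • χ + s • e) (φ + t • χ + s • e)) 0) 0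
    = 2 * M e χ + 4 * (Q e χ φ φ + Q e φ χ φ + Q e φ φ χ) := by
  have Mr : ∀ f g g' (t : ℝ), M f (g + t • g') = M f g + t * M f g' := by
    intro f g g' t
    rw [Ms, Ml, Ms g, Ms g']
  have Qb : ∀ f g g' h k (t : ℝ), Q f (g + t • g') h k = Q f g h k + t * Q f g' h k := by
    intro f g g' h k t
    rw [Q1, Ql, Q1 g, Q1 g']
  have Qc : ∀ f g h h' k (t : ℝ), Q f g (h + t • h') k = Q f g h k + t * Q f g h' k := by
    intro f g h h' k t
    rw [Q2, Ql, Q2 h, Q2 h']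
  have Qd : ∀ f g h k k' (t : ℝ), Q f g h (k + t • k') = Q f g h k + t * Q f g h k' := by
    intro f g h k k' t
    rw [Q2, Qb, Q2 h, Q2 h]
  have inner_eq : ∀ s : ℝ, deriv (fun t : ℝ =>
      M (φ + t • χ + s • e) (φ + t • χ + s • e)
      + Q (φ + t • χ + s • e) (φ + t • χ + s • e) (φ + t • χ + s • e) (φ + t • χ + s • e)) 0
      = 2 * M χ (φ + s • e) + 4 * Q χ (φ + s • e) (φ + s • e) (φ + s • e) := by
    intro s
    rw [show (fun t : ℝ => M (φ + t • χ + s • e) (φ + t • χ + s • e)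
      + Q (φ + t • χ + s • e) (φ + t • χ + s • e) (φ + t • χ + s • e) (φ + t • χ + s • e))
      = fun t : ℝ => M ((φ + s • e) + t • χ) ((φ + s • e) + t • χ)
      + Q ((φ + s • e) + t • χ) ((φ + s • e) + t • χ) ((φ + s • e) + t • χ)
        ((φ + s • e) + t • χ) from by
      funext t
      rw [add_right_comm]]
    generalize φ + s • e = f
    have key := deriv_poly4 (M f f + Q f f f f) (2 * M χ f + 4 * Q χ f f f)
      (M χ χ + Q χ χ f f + Q χ f χ f + Q χ f f χ + Q f χ χ f + Q f χ f χ + Q f f χ χ)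
      (Q χ χ χ f + Q χ χ f χ + Q χ f χ χ + Q f χ χ χ) (Q χ χ χ χ)
    rw [← key]
    congr 1
    funext t
    simp only [Ml, Mr, Ql, Qb, Qc, Qd]
    rw [Ms f χ, Q1 f χ f f, Q2 f f χ f, Q1 f f f χ, Q2 f f χ f]
    ring
  simp only [inner_eq]
  have key := deriv_poly4 (2 * M χ φ + 4 * Q χ φ φ φ)
    (2 * M e χ + 4 * (Q e χ φ φ + Q e φ χ φ + Q e φ φ χ))
    (4 * (Q χ e e φ + Q χ e φ e + Q χ φ e e)) (4 * Q χ e e e) 0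
  refine Eq.trans ?_ key
  congr 1
  funext s
  simp only [Mr, Qb, Qc, Qd]
  rw [Ms χ e, Q1 χ e φ φ, Q2 χ φ e φ, Q1 χ φ φ e, Q2 φ χ e φ]
  ring

/-- Sixfold sum. -/
def sum6 (N : ℕ) (F : Fin N → Fin N → Fin N → Fin N → Fin N → Fin N → ℝ) : ℝ :=
  ∑ a, ∑ b, ∑ c, ∑ a', ∑ b', ∑ c', F a b c a' b' c'

lemma sum6_prod (N : ℕ) (F : Fin N → Fin N → Fin N → Fin N → Fin N → Fin N → ℝ) :
    sum6 N F = ∑ p : Fin N × Fin N × Fin N × Fin N × Fin N × Fin N,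
      F p.1 p.2.1 p.2.2.1 p.2.2.2.1 p.2.2.2.2.1 p.2.2.2.2.2 := by
  simp only [sum6, Fintype.sum_prod_type]

lemma sum6_a (N : ℕ) (F : Fin N → Fin N → Fin N → Fin N → Fin N → Fin N → ℝ) :
    sum6 N F = sum6 N (fun a b c a' b' c' => F a' b c a b' c') := by
  rw [sum6_prod, sum6_prod]
  exact Fintype.sum_equiv
    ⟨fun p => (p.2.2.2.1, p.2.1, p.2.2.1, p.1, p.2.2.2.2.1, p.2.2.2.2.2),
     fun p => (p.2.2.2.1, p.2.1, p.2.2.1, p.1, p.2.2.2.2.1, p.2.2.2.2.2),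
     fun _ => rfl, fun _ => rfl⟩ _ _ (fun _ => rfl)

lemma sum6_b (N : ℕ) (F : Fin N → Fin N → Fin N → Fin N → Fin N → Fin N → ℝ) :
    sum6 N F = sum6 N (fun a b c a' b' c' => F a b' c a' b c') := by
  rw [sum6_prod, sum6_prod]
  exact Fintype.sum_equiv
    ⟨fun p => (p.1, p.2.2.2.2.1, p.2.2.1, p.2.2.2.1, p.2.1, p.2.2.2.2.2),
     fun p => (p.1, p.2.2.2.2.1, p.2.2.1, p.2.2.2.1, p.2.1, p.2.2.2.2.2),
     fun _ => rfl, fun _ => rfl⟩ _ _ (fun _ => rfl)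

lemma sum6_c (N : ℕ) (F : Fin N → Fin N → Fin N → Fin N → Fin N → Fin N → ℝ) :
    sum6 N F = sum6 N (fun a b c a' b' c' => F a b c' a' b' c) := by
  rw [sum6_prod, sum6_prod]
  exact Fintype.sum_equiv
    ⟨fun p => (p.1, p.2.1, p.2.2.2.2.2, p.2.2.2.1, p.2.2.2.2.1, p.2.2.1),
     fun p => (p.1, p.2.1, p.2.2.2.2.2, p.2.2.2.1, p.2.2.2.2.1, p.2.2.1),
     fun _ => rfl, fun _ => rfl⟩ _ _ (fun _ => rfl)

lemma sum6_lin (N : ℕ) (F G H : Fin N → Fin N → Fin N → Fin N → Fin N → Fin N → ℝ) (t : ℝ)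
    (h : ∀ a b c a' b' c', F a b c a' b' c' = G a b c a' b' c' + t * H a b c a' b' c') :
    sum6 N F = sum6 N G + t * sum6 N H := by
  simp only [sum6, h, Finset.sum_add_distrib, Finset.mul_sum]

lemma sum6_congr (N : ℕ) (F G : Fin N → Fin N → Fin N → Fin N → Fin N → Fin N → ℝ)
    (h : ∀ a b c a' b' c', F a b c a' b' c' = G a b c a' b' c') :
    sum6 N F = sum6 N G := by
  simp only [sum6, h]

/-- Tensor fields. -/
abbrev TF (N : ℕ) := Fin N → Fin N → Fin N → ℝ

def ip (N : ℕ) (f g : TF N) : ℝ := ∑ a, ∑ b, ∑ c, f a b c * g a b c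

lemma ip_comm (N : ℕ) (f g : TF N) : ip N f g = ip N g f := by
  simp only [ip, mul_comm]

lemma ip_lin (N : ℕ) (f f' g : TF N) (t : ℝ) :
    ip N (f + t • f') g = ip N f g + t * ip N f' g := by
  simp only [ip, Pi.add_apply, Pi.smul_apply, smul_eq_mul, add_mul, Finset.sum_add_distrib,
    Finset.mul_sum, mul_assoc]

def P1 (N : ℕ) (f g h k : TF N) : ℝ :=
  sum6 N fun a b c a' b' c' => f a b c * g a b' c' * h a' b' c' * k a' b c

def P2 (N : ℕ) (f g h k : TF N) : ℝ :=
  sum6 N fun a b c a' b' c' => f a b c * g a' b c' * h a' b' c' * k a b' c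

def P3 (N : ℕ) (f g h k : TF N) : ℝ :=
  sum6 N fun a b c a' b' c' => f a b c * g a' b' c * h a' b' c' * k a b c'

def P4 (N : ℕ) (f g h k : TF N) : ℝ :=
  sum6 N fun a b c a' b' c' => f a b c * g a b' c' * h a' b c' * k a' b' c

lemma P1_lin (N : ℕ) (f f' g h k : TF N) (t : ℝ) :
    P1 N (f + t • f') g h k = P1 N f g h k + t * P1 N f' g h k := by
  apply sum6_lin
  intros
  simp only [Pi.add_apply, Pi.smul_apply, smul_eq_mul]
  ring

lemma P2_lin (N : ℕ) (f f' g h k : TF N) (t : ℝ) :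
    P2 N (f + t • f') g h k = P2 N f g h k + t * P2 N f' g h k := by
  apply sum6_lin
  intros
  simp only [Pi.add_apply, Pi.smul_apply, smul_eq_mul]
  ring

lemma P3_lin (N : ℕ) (f f' g h k : TF N) (t : ℝ) :
    P3 N (f + t • f') g h k = P3 N f g h k + t * P3 N f' g h k := by
  apply sum6_lin
  intros
  simp only [Pi.add_apply, Pi.smul_apply, smul_eq_mul]
  ring

lemma P4_lin (N : ℕ) (f f' g h k : TF N) (t : ℝ) :
    P4 N (f + t • f') g h k = P4 N f g h k + t * P4 N f' g h k := by
  apply sum6_lin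
  intros
  simp only [Pi.add_apply, Pi.smul_apply, smul_eq_mul]
  ring

lemma P1_s1 (N : ℕ) (f g h k : TF N) : P1 N f g h k = P1 N g f k h := by
  unfold P1
  rw [sum6_b, sum6_c]
  apply sum6_congr
  intros
  ring

lemma P1_s2 (N : ℕ) (f g h k : TF N) : P1 N f g h k = P1 N h k f g := by
  unfold P1
  rw [sum6_a, sum6_b, sum6_c]
  apply sum6_congr
  intros
  ring

lemma P2_s1 (N : ℕ) (f g h k : TF N) : P2 N f g h k = P2 N g f k h := by
  unfold P2
  rw [sum6_a, sum6_c]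
  apply sum6_congr
  intros
  ring

lemma P2_s2 (N : ℕ) (f g h k : TF N) : P2 N f g h k = P2 N h k f g := by
  unfold P2
  rw [sum6_a, sum6_b, sum6_c]
  apply sum6_congr
  intros
  ring

lemma P3_s1 (N : ℕ) (f g h k : TF N) : P3 N f g h k = P3 N g f k h := by
  unfold P3
  rw [sum6_a, sum6_b]
  apply sum6_congr
  intros
  ring

lemma P3_s2 (N : ℕ) (f g h k : TF N) : P3 N f g h k = P3 N h k f g := by
  unfold P3
  rw [sum6_a, sum6_b, sum6_c]
  apply sum6_congr
  intros
  ring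

lemma P4_s1 (N : ℕ) (f g h k : TF N) : P4 N f g h k = P4 N g f k h := by
  unfold P4
  rw [sum6_b, sum6_c]
  apply sum6_congr
  intros
  ring

lemma P4_s2 (N : ℕ) (f g h k : TF N) : P4 N f g h k = P4 N h k f g := by
  unfold P4
  rw [sum6_a, sum6_c]
  apply sum6_congr
  intros
  ring

/-- The polarized quartic form. -/
noncomputable def QF (N : ℕ) (ld lp lt a1 a2 a3 : ℝ) (f g h k : TF N) : ℝ :=
  ld / (4 * (N : ℝ) ^ 3) * (ip N f g * ip N h k)
  + lp / (4 * (N : ℝ) ^ 2) * (a1 * P1 N f g h k + a2 * P2 N f g h k + a3 * P3 N f g h k)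
  + lt / (4 * (N : ℝ) ^ ((3 : ℝ) / 2)) * P4 N f g h k

lemma potV_eq (N : ℕ) (l2 ld lp lt a1 a2 a3 : ℝ) (f : TF N) :
    potV N l2 ld lp lt a1 a2 a3 f = l2 / 2 * ip N f f + QF N ld lp lt a1 a2 a3 f f f f := by
  simp only [potV, QF, ip, P1, P2, P3, P4, sum6, pow_two]
  ring

/-- Indicator tensor. -/
def ind (N : ℕ) (a b c : Fin N) : TF N :=
  fun a' b' c' => if a' = a ∧ b' = b ∧ c' = c then (1 : ℝ) else 0

lemma sum_ind (N : ℕ) (a b c : Fin N) (F : TF N) :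
    ∑ x, ∑ y, ∑ z, ind N a b c x y z * F x y z = F a b c := by
  simp [ind, ite_and, Finset.sum_ite_eq]

lemma sum6_ind (N : ℕ) (a b c : Fin N)
    (G F : Fin N → Fin N → Fin N → Fin N → Fin N → Fin N → ℝ)
    (h : ∀ x y z a' b' c', G x y z a' b' c' = ind N a b c x y z * F x y z a' b' c') :
    sum6 N G = ∑ a', ∑ b', ∑ c', F a b c a' b' c' := by
  simp only [sum6, h, ← Finset.mul_sum]
  exact sum_ind N a b c (fun x y z => ∑ a', ∑ b', ∑ c', F x y z a' b' c')

lemma hessApply_eq (N : ℕ) (l2 ld lp lt a1 a2 a3 : ℝ) (φ χ : TF N) (a b c : Fin N) :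
    hessApply N l2 ld lp lt a1 a2 a3 φ χ a b c =
      2 * (l2 / 2 * ip N (ind N a b c) χ) + 4 * (QF N ld lp lt a1 a2 a3 (ind N a b c) χ φ φ
        + QF N ld lp lt a1 a2 a3 (ind N a b c) φ χ φ
        + QF N ld lp lt a1 a2 a3 (ind N a b c) φ φ χ) := by
  unfold hessApply
  simp only [potV_eq]
  refine hess_abs (fun f g : TF N => l2 / 2 * ip N f g) (QF N ld lp lt a1 a2 a3)
    ?_ ?_ ?_ ?_ ?_ φ χ (ind N a b c)
  · intro f f' g t
    simp only [ip_lin]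
    ring
  · intro f g
    simp only [ip_comm N f g]
  · intro f f' g h k t
    simp only [QF, ip_lin, P1_lin, P2_lin, P3_lin, P4_lin]
    ring
  · intro f g h k
    unfold QF
    rw [P1_s1, P2_s1, P3_s1, P4_s1, ip_comm N f g, ip_comm N h k]
  · intro f g h k
    unfold QF
    rw [P1_s2, P2_s2, P3_s2, P4_s2, mul_comm (ip N f g)]

/-- Product tensor. -/
def pt (N : ℕ) (u : Fin N → ℝ) (S : Fin N → Fin N → ℝ) : TF N := fun a b c => u a * S b c

lemma ip_pt (N : ℕ) (u : Fin N → ℝ) (S T : Fin N → Fin N → ℝ) :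
    ip N (pt N u S) (pt N u T) = (∑ a, u a ^ 2) * ∑ b, ∑ c, S b c * T b c := by
  simp only [ip, pt, Finset.sum_mul]
  refine Finset.sum_congr rfl fun a _ => ?_
  simp only [Finset.mul_sum]
  refine Finset.sum_congr rfl fun b _ => Finset.sum_congr rfl fun c _ => ?_
  ring

lemma ip_ind (N : ℕ) (f : TF N) (a b c : Fin N) : ip N (ind N a b c) f = f a b c :=
  sum_ind N a b c f

lemma fac3 (N : ℕ) (r : ℝ) (u : Fin N → ℝ) (F : TF N) (K : Fin N → Fin N → ℝ)
    (h : ∀ x y z, F x y z = r * (u x ^ 2 * K y z)) :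
    ∑ x, ∑ y, ∑ z, F x y z = r * ((∑ x, u x ^ 2) * ∑ y, ∑ z, K y z) := by
  simp only [h, ← Finset.mul_sum, ← Finset.sum_mul]

lemma P1_pt (N : ℕ) (u : Fin N → ℝ) (S T U : Fin N → Fin N → ℝ) (a b c : Fin N) :
    P1 N (ind N a b c) (pt N u S) (pt N u T) (pt N u U)
      = u a * ((∑ x, u x ^ 2) * ∑ y, ∑ z, S y z * T y z * U b c) := by
  unfold P1
  rw [sum6_ind N a b c _ (fun a b c a' b' c' =>
    pt N u S a b' c' * pt N u T a' b' c' * pt N u U a' b c) (by intros; ring)]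
  apply fac3
  intros
  simp only [pt]
  ring

lemma P2_pt (N : ℕ) (u : Fin N → ℝ) (S T U : Fin N → Fin N → ℝ) (a b c : Fin N) :
    P2 N (ind N a b c) (pt N u S) (pt N u T) (pt N u U)
      = u a * ((∑ x, u x ^ 2) * ∑ y, ∑ z, S b z * T y z * U y c) := by
  unfold P2
  rw [sum6_ind N a b c _ (fun a b c a' b' c' =>
    pt N u S a' b c' * pt N u T a' b' c' * pt N u U a b' c) (by intros; ring)]
  apply fac3
  intros
  simp only [pt]
  ring

lemma P3_pt (N : ℕ) (u : Fin N → ℝ) (S T U : Fin N → Fin N → ℝ) (a b c : Fin N) :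
    P3 N (ind N a b c) (pt N u S) (pt N u T) (pt N u U)
      = u a * ((∑ x, u x ^ 2) * ∑ y, ∑ z, S y c * T y z * U b z) := by
  unfold P3
  rw [sum6_ind N a b c _ (fun a b c a' b' c' =>
    pt N u S a' b' c * pt N u T a' b' c' * pt N u U a b c') (by intros; ring)]
  apply fac3
  intros
  simp only [pt]
  ring

lemma P4_pt (N : ℕ) (u : Fin N → ℝ) (S T U : Fin N → Fin N → ℝ) (a b c : Fin N) :
    P4 N (ind N a b c) (pt N u S) (pt N u T) (pt N u U)
      = u a * ((∑ x, u x ^ 2) * ∑ y, ∑ z, S y z * T b z * U y c) := by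
  unfold P4
  rw [sum6_ind N a b c _ (fun a b c a' b' c' =>
    pt N u S a b' c' * pt N u T a' b c' * pt N u U a' b' c) (by intros; ring)]
  apply fac3
  intros
  simp only [pt]
  ring

/-- Kronecker delta. -/
def kd (N : ℕ) : Fin N → Fin N → ℝ := fun b c => if b = c then (1 : ℝ) else 0

lemma hess_pt (N : ℕ) (hN : 1 ≤ N) (l2 ld lp lt a1 a2 a3 : ℝ) (u : Fin N → ℝ)
    (S : Fin N → Fin N → ℝ) (hS : ∀ b c, S b c = S c b) (a b c : Fin N) :
    hessApply N l2 ld lp lt a1 a2 a3 (pt N u (kd N)) (pt N u S) a b c =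
      (l2 + (∑ x, u x ^ 2) / (N : ℝ) ^ 2 * (ld + lp * (N * a1 + 3 * a2 + 3 * a3)
        + 3 * (N : ℝ) ^ ((1 : ℝ) / 2) * lt)) * (u a * S b c)
      + (∑ x, u x ^ 2) / (N : ℝ) ^ 2 * (2 * ld / N + 2 * lp * a1) * (∑ y, S y y)
        * (u a * kd N b c) := by
  have hpos : (0 : ℝ) < N := by exact_mod_cast hN
  have e1 : (N : ℝ) ^ ((3 : ℝ) / 2) = (N : ℝ) ^ 2 / (N : ℝ) ^ ((1 : ℝ) / 2) := by
    rw [show ((3 : ℝ) / 2) = (2 : ℕ) - 1 / 2 by norm_num, Real.rpow_sub hpos, Real.rpow_natCast]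
  have hr : (N : ℝ) ^ ((1 : ℝ) / 2) ≠ 0 := (Real.rpow_pos_of_pos hpos _).ne'
  rw [hessApply_eq]
  simp only [QF, ip_ind, ip_pt, P1_pt, P2_pt, P3_pt, P4_pt, e1]
  generalize (N : ℝ) ^ ((1 : ℝ) / 2) = r at *
  generalize ∑ x, u x ^ 2 = U
  have hc : S c b = S b c := hS c b
  simp [kd, pt, Finset.sum_ite_eq, ← Finset.sum_mul, hc]
  generalize ∑ y, S y y = τ
  generalize S b c = w
  by_cases hbc : b = c
  · simp only [hbc, if_true]
    field_simp
    ring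
  · simp only [hbc, if_false]
    field_simp
    ring

/-- Eigenvalues of the Hessian at the solution `φ_{abc} = u_a δ_{bc}` on the directions
`u ⊗ δ` (the solution itself) and `u ⊗ S` for symmetric traceless `S`. -/
theorem vector_delta_hessian_uS (N : ℕ) (hN : 1 ≤ N)
    (l2 ld lp lt a1 a2 a3 : ℝ)
    (u : Fin N → ℝ)
    (φ : Fin N → Fin N → Fin N → ℝ)
    (hφ : φ = fun a b c => u a * (if b = c then (1 : ℝ) else 0))
    (D' : ℝ)
    (hD' : D' = ld + lp * ((N : ℝ) * a1 + a2 + a3) + (N : ℝ) ^ ((1 : ℝ) / 2) * lt)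
    (hD0 : D' ≠ 0)
    (hsol : ∑ a, (u a) ^ 2 = -l2 * (N : ℝ) ^ 2 / D') :
    (hessApply N l2 ld lp lt a1 a2 a3 φ
        (fun a b c => u a * (if b = c then (1 : ℝ) else 0))
      = fun a b c => -2 * l2 * (u a * (if b = c then (1 : ℝ) else 0)))
    ∧ (∀ S : Fin N → Fin N → ℝ, (∀ b c, S b c = S c b) → (∑ b, S b b) = 0 →
        hessApply N l2 ld lp lt a1 a2 a3 φ (fun a b c => u a * S b c)
          = fun a b c =>
            -2 * l2 * ((N : ℝ) ^ ((1 : ℝ) / 2) * lt + (a2 + a3) * lp) / D' *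
              (u a * S b c)) := by
  have hpos : (0 : ℝ) < N := by exact_mod_cast hN
  have hφ' : φ = pt N u (kd N) := hφ
  subst hφ'
  constructor
  · funext a b c
    have h := hess_pt N hN l2 ld lp lt a1 a2 a3 u (kd N)
      (by intro b c; simp only [kd, eq_comm]) a b c
    refine Eq.trans h ?_
    have ht : ∑ y, kd N y y = (N : ℝ) := by simp [kd]
    rw [ht, hsol]
    change _ = -2 * l2 * (u a * kd N b c)
    generalize u a * kd N b c = w
    generalize (N : ℝ) ^ ((1 : ℝ) / 2) = r at *
    field_simp
    rw [hD']
    ring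
  · intro S hS hT
    funext a b c
    refine Eq.trans (hess_pt N hN l2 ld lp lt a1 a2 a3 u S hS a b c) ?_
    rw [hT, hsol]
    generalize (N : ℝ) ^ ((1 : ℝ) / 2) = r at *
    generalize u a * S b c = w
    field_simp
    rw [hD']
    ring
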